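/- Under Assumption 1, the transformed value function v : ℝⁿ → [0, 1], v(x) = 1 − e^{−V(x)}, is continuous on all of ℝⁿ. -/

import Mathlib

open Metric Set Filter MeasureTheory

noncomputable section

abbrev St (n : ℕ) := EuclideanSpace ℝ (Fin n)

/-- Trajectory of the perturbed discrete-time system. -/
def traj {n m : ℕ} (f : St n → St m → St n) (x₀ : St n) (π : ℕ → St m) : ℕ → St n
  | 0 => x₀
  | k + 1 => f (traj f x₀ π k) (π k)

/-- A perturbation input policy takes values in `D`. -/
def IsPolicy {m : ℕ} (D : Set (St m)) (π : ℕ → St m) : Prop := ∀ k, π k ∈ D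

/-- Maximal robust region of attraction. -/
def RoA {n m : ℕ} (f : St n → St m → St n) (D : Set (St m)) (X : Set (St n)) : Set (St n) :=
  {x₀ | ∀ π, IsPolicy D π →
    (∀ k, traj f x₀ π k ∈ X) ∧ Tendsto (fun k => traj f x₀ π k) atTop (nhds 0)}

/-- `f` is a polynomial map in `(x, d)`. -/
def IsPolyMap2 {n m : ℕ} (f : St n → St m → St n) : Prop :=
  ∃ p : Fin n → MvPolynomial (Fin n ⊕ Fin m) ℝ,
    ∀ x d i, f x d i = MvPolynomial.eval (Sum.elim x d) (p i)

/-- A real-valued polynomial function on the state space. -/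
def IsPolyFun {n : ℕ} (g : St n → ℝ) : Prop :=
  ∃ p : MvPolynomial (Fin n) ℝ, ∀ x, g x = MvPolynomial.eval x p

/-- Assumption 1: uniform local exponential stability. -/
def Assumption1 {n m : ℕ} (f : St n → St m → St n) (D : Set (St m)) (X : Set (St n)) : Prop :=
  ∃ M r lam : ℝ, 0 < M ∧ 0 < r ∧ 0 < lam ∧ lam < 1 ∧ closedBall (0 : St n) r ⊆ X ∧
    ∀ x₀ ∈ closedBall (0 : St n) r, ∀ π, IsPolicy D π →
      ∀ k, ‖traj f x₀ π k‖ ≤ lam ^ k * M * ‖x₀‖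

/-- Maximal robust region of uniform attraction (with ball radius `ε`). -/
def R0 {n m : ℕ} (f : St n → St m → St n) (D : Set (St m)) (X : Set (St n)) (ε : ℝ) :
    Set (St n) :=
  {x₀ | (∃ δ > 0, ∀ π, IsPolicy D π → ∀ k, δ < infDist (traj f x₀ π k) Xᶜ) ∧
        (∃ K : ℕ, ∀ π, IsPolicy D π →
            ∃ k, 0 < k ∧ k ≤ K ∧ traj f x₀ π k ∈ closedBall (0 : St n) ε)}

/-- Extended-real logarithm with the convention `ln 0 = -∞`. -/
def elog (t : ℝ) : EReal := if t = 0 then ⊥ else (Real.log t : EReal)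

/-- The value function `V`. -/
def Vval {n m nX : ℕ} (f : St n → St m → St n) (D : Set (St m))
    (hX : Fin nX → St n → ℝ) (g : St n → ℝ) (x : St n) : EReal :=
  ⨆ π ∈ {π : ℕ → St m | IsPolicy D π}, ⨆ k : ℕ,
    ((∑ i ∈ Finset.range k, Real.log (g (traj f x π i) + 1) : ℝ) : EReal)
      - ⨅ j : Fin nX, elog (max (1 - hX j (traj f x π k)) 0)

/-- The Kruzhkov transformed value function `v = 1 - e^{-V}` (with `e^{-∞} = 0`). -/
def vval {n m nX : ℕ} (f : St n → St m → St n) (D : Set (St m))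
    (hX : Fin nX → St n → ℝ) (g : St n → ℝ) (x : St n) : ℝ :=
  if Vval f D hX g x = ⊤ then 1 else 1 - Real.exp (-(Vval f D hX g x).toReal)

/-- `w` is a (bounded continuous) solution of the Bellman equation. -/
def IsBellmanSolution {n m nX : ℕ} (f : St n → St m → St n) (D : Set (St m))
    (hX : Fin nX → St n → ℝ) (g : St n → ℝ) (w : St n → ℝ) : Prop :=
  (∀ x, min (sInf {y : ℝ | ∃ d ∈ D, y = w x - w (f x d) - g x * (1 - w x)})
            (w x - 1 + ⨅ j : Fin nX, max (1 - hX j x) 0) = 0) ∧ w 0 = 0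

open scoped ENNReal

section PolynomialRegularity

variable {n m : ℕ}

lemma IsPolyFun.differentiable {g : St n → ℝ} (hg : IsPolyFun g) : Differentiable ℝ g := by
  obtain ⟨p, hp⟩ := hg
  have h := AnalyticOnNhd.eval_continuousLinearMap'
    (fun i => (EuclideanSpace.proj i : St n →L[ℝ] ℝ)) p
  have hgp : g = fun x => MvPolynomial.eval
      (fun i => (EuclideanSpace.proj i : St n →L[ℝ] ℝ) x) p := funext hp
  rw [hgp]
  exact fun x => (h x (mem_univ x)).differentiableAt

lemma IsPolyMap2.continuous {f : St n → St m → St n} (hf : IsPolyMap2 f) :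
    Continuous fun z : St n × St m => f z.1 z.2 := by
  obtain ⟨p, hp⟩ := hf
  refine (PiLp.continuous_toLp 2 _).comp
    (g := WithLp.toLp 2) (f := fun z : St n × St m => (f z.1 z.2).ofLp) (continuous_pi fun i => ?_)
  simp only [hp]
  refine (MvPolynomial.continuous_eval (p i)).comp (continuous_pi fun s => ?_)
  cases s <;> simp only [Sum.elim_inl, Sum.elim_inr] <;> fun_prop

end PolynomialRegularity

section Trajectories

variable {n m : ℕ} {f : St n → St m → St n}

lemma continuous_traj (hf : Continuous fun z : St n × St m => f z.1 z.2) (k : ℕ) :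
    Continuous fun z : St n × (ℕ → St m) => traj f z.1 z.2 k := by
  induction k with
  | zero => exact continuous_fst
  | succ k ih => exact hf.comp (ih.prodMk ((continuous_apply k).comp continuous_snd))

lemma traj_add (f : St n → St m → St n) (x : St n) (π : ℕ → St m) (s k : ℕ) :
    traj f x π (s + k) = traj f (traj f x π s) (fun i => π (s + i)) k := by
  induction k with
  | zero => rfl
  | succ k ih => rw [← add_assoc, traj, traj, ih]

end Trajectories

/-- The exponential of the negated payoff collected along a trajectory up to time `k`, measured
against the `j`-th constraint. -/
def pathGain {n m nX : ℕ} (f : St n → St m → St n) (hX : Fin nX → St n → ℝ) (g : St n → ℝ)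
    (k : ℕ) (j : Fin nX) (x : St n) (π : ℕ → St m) : ℝ :=
  Real.exp (-∑ i ∈ Finset.range k, Real.log (g (traj f x π i) + 1)) * (1 - hX j (traj f x π k))

/-- The infimum of all path gains, equal to `e^{-V}`. -/
def gainInf {n m nX : ℕ} (f : St n → St m → St n) (D : Set (St m)) (hX : Fin nX → St n → ℝ)
    (g : St n → ℝ) (x : St n) : ℝ≥0∞ :=
  ⨅ π ∈ {π : ℕ → St m | IsPolicy D π}, ⨅ k : ℕ, ⨅ j : Fin nX,
    ENNReal.ofReal (pathGain f hX g k j x π)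

section Transform

variable {n m nX : ℕ} {f : St n → St m → St n} {D : Set (St m)} {hX : Fin nX → St n → ℝ}
  {g : St n → ℝ}

lemma exp_elog_max (t : ℝ) : EReal.exp (elog (max t 0)) = ENNReal.ofReal t := by
  unfold elog
  split_ifs with h
  · rw [EReal.exp_bot, ENNReal.ofReal_of_nonpos (max_eq_right_iff.mp h)]
  · have h0 : 0 < t := by
      by_contra hn
      exact h (max_eq_right (not_lt.mp hn))
    rw [EReal.exp_coe, max_eq_left h0.le, Real.exp_log h0]

lemma exp_neg_iSup {ι : Sort*} (u : ι → EReal) :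
    EReal.exp (-⨆ i, u i) = ⨅ i, EReal.exp (-u i) := by
  have h : -(⨆ i, u i) = ⨅ i, -u i := EReal.negOrderIso.map_iSup u
  rw [h]
  exact EReal.expOrderIso.map_iInf _

lemma exp_neg_Vval (x : St n) : EReal.exp (-Vval f D hX g x) = gainInf f D hX g x := by
  unfold Vval gainInf
  simp only [exp_neg_iSup]
  refine iInf_congr fun π => iInf_congr fun _ => iInf_congr fun k => ?_
  have hI (u : Fin nX → EReal) : EReal.exp (⨅ j, u j) = ⨅ j, EReal.exp (u j) :=
    EReal.expOrderIso.map_iInf _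
  rw [EReal.neg_sub (.inl (EReal.coe_ne_bot _)) (.inl (EReal.coe_ne_top _)), EReal.exp_add,
    ← EReal.coe_neg, EReal.exp_coe, hI]
  simp only [exp_elog_max, pathGain, ENNReal.ofReal_mul (Real.exp_nonneg _)]
  exact ENNReal.mul_iInf_of_ne (by simp [Real.exp_pos]) ENNReal.ofReal_ne_top

lemma vval_eq_one_sub {x : St n} (h : Vval f D hX g x ≠ ⊥) :
    vval f D hX g x = 1 - (gainInf f D hX g x).toReal := by
  rw [← exp_neg_Vval, vval]
  generalize Vval f D hX g x = V at h
  induction V with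
  | bot => exact absurd rfl h
  | top => simp
  | coe t => simp [← EReal.coe_neg, Real.exp_nonneg]

end Transform

section Gain

variable {n m nX : ℕ} {f : St n → St m → St n} {D : Set (St m)} {hX : Fin nX → St n → ℝ}
  {g : St n → ℝ}

lemma continuous_pathGain (hf : Continuous fun z : St n × St m => f z.1 z.2)
    (hh : ∀ j, Continuous (hX j)) (hg : Continuous g) (hg0 : ∀ x, 0 ≤ g x) (k : ℕ) (j : Fin nX) :
    Continuous fun z : St n × (ℕ → St m) => pathGain f hX g k j z.1 z.2 := by
  unfold pathGain
  refine (Real.continuous_exp.comp (continuous_finsetSum _ fun i _ => ?_).neg).mul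
    (continuous_const.sub ((hh j).comp (continuous_traj hf k)))
  exact ((hg.comp (continuous_traj hf i)).add continuous_const).log
    fun z => (add_pos_of_nonneg_of_pos (hg0 _) one_pos).ne'

lemma pathGain_add (s k : ℕ) (j : Fin nX) (x : St n) (π : ℕ → St m) :
    pathGain f hX g (s + k) j x π =
      Real.exp (-∑ i ∈ Finset.range s, Real.log (g (traj f x π i) + 1)) *
        pathGain f hX g k j (traj f x π s) (fun i => π (s + i)) := by
  simp only [pathGain, Finset.sum_range_add, traj_add, neg_add, Real.exp_add, mul_assoc]

lemma sum_log_nonneg (hg0 : ∀ x, 0 ≤ g x) (k : ℕ) (x : St n) (π : ℕ → St m) :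
    0 ≤ ∑ i ∈ Finset.range k, Real.log (g (traj f x π i) + 1) :=
  Finset.sum_nonneg fun i _ => Real.log_nonneg (by linarith [hg0 (traj f x π i)])

lemma pathGain_le_exp (hh0 : ∀ j x, 0 ≤ hX j x) (k : ℕ) (j : Fin nX) (x : St n)
    (π : ℕ → St m) :
    pathGain f hX g k j x π ≤
      Real.exp (-∑ i ∈ Finset.range k, Real.log (g (traj f x π i) + 1)) :=
  mul_le_of_le_one_right (Real.exp_nonneg _) (by linarith [hh0 j (traj f x π k)])

lemma le_one_sub_of_le_pathGain (hg0 : ∀ x, 0 ≤ g x) {c : ℝ} (hc : 0 < c) {k : ℕ} {j : Fin nX}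
    {x : St n} {π : ℕ → St m} (h : c ≤ pathGain f hX g k j x π) :
    c ≤ 1 - hX j (traj f x π k) := by
  have hpos : 0 < 1 - hX j (traj f x π k) :=
    pos_of_mul_pos_right (hc.trans_le h) (Real.exp_nonneg _)
  refine h.trans (mul_le_of_le_one_left hpos.le ?_)
  exact Real.exp_le_one_iff.mpr (neg_nonpos.mpr (sum_log_nonneg hg0 k x π))

/-- Under uniform exponential stability, path gains are uniformly close to `1` near the origin. -/
lemma exists_ball_le_pathGain {X : Set (St n)} (hA : Assumption1 f D X)
    (hh : ∀ j, Continuous (hX j)) (hX0 : ∀ j, hX j 0 = 0) (hh0 : ∀ j x, 0 ≤ hX j x)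
    (hgd : Differentiable ℝ g) (hg0 : ∀ x, 0 ≤ g x) (hgz : g 0 = 0) {q : ℝ} (hq : q < 1) :
    ∃ ρ > 0, ∀ z : St n, ‖z‖ < ρ → ∀ π, IsPolicy D π → ∀ k j, q ≤ pathGain f hX g k j z π := by
  obtain ⟨M, r, lam, hM, hr, hl0, hl1, -, hstab⟩ := hA
  have hη : 0 < (1 - q) / 2 := by linarith
  obtain ⟨C, hC, hCg⟩ := (hgd 0).hasFDerivAt.isBigO_sub.exists_pos
  have hev : ∀ᶠ w : St n in nhds 0, g w ≤ C * ‖w‖ ∧ ∀ j, hX j w < (1 - q) / 2 := by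
    refine (hCg.bound.mono fun w hw => ?_).and (eventually_all.mpr fun j => ?_)
    · simpa [hgz, abs_of_nonneg (hg0 w)] using hw
    · exact (hh j).continuousAt.eventually_lt_const (by rwa [hX0])
  obtain ⟨δ, hδ, hball⟩ := Metric.eventually_nhds_iff.mp hev
  have hB : 0 < C * M / (1 - lam) := div_pos (mul_pos hC hM) (by linarith)
  refine ⟨min r (min (δ / M) ((1 - q) / 2 / (C * M / (1 - lam)))),
    lt_min hr (lt_min (div_pos hδ hM) (div_pos hη hB)), fun z hz π hπ k j => ?_⟩
  obtain ⟨hzr, hz⟩ := lt_min_iff.mp hz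
  obtain ⟨hzδ, hzη⟩ := lt_min_iff.mp hz
  rw [lt_div_iff₀ hM] at hzδ
  rw [lt_div_iff₀ hB] at hzη
  have htraj := hstab z (by simpa using hzr.le) π hπ
  have hclose (i : ℕ) : g (traj f z π i) ≤ C * ‖traj f z π i‖ ∧
      ∀ j, hX j (traj f z π i) < (1 - q) / 2 := by
    refine hball ?_
    rw [dist_zero_right]
    have h1 : lam ^ i * (M * ‖z‖) ≤ 1 * (M * ‖z‖) :=
      mul_le_mul_of_nonneg_right (pow_le_one₀ hl0.le hl1.le) (by positivity)
    linarith [htraj i]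
  have hsum : ∑ i ∈ Finset.range k, Real.log (g (traj f z π i) + 1) ≤ (1 - q) / 2 := by
    calc ∑ i ∈ Finset.range k, Real.log (g (traj f z π i) + 1)
        ≤ ∑ i ∈ Finset.range k, lam ^ i * (C * M * ‖z‖) := by
          refine Finset.sum_le_sum fun i _ => ?_
          have h1 := Real.log_le_sub_one_of_pos
            (add_pos_of_nonneg_of_pos (hg0 (traj f z π i)) one_pos)
          have h2 := mul_le_mul_of_nonneg_left (htraj i) hC.le
          linarith [(hclose i).1]
      _ = (∑ i ∈ Finset.range k, lam ^ i) * (C * M * ‖z‖) := (Finset.sum_mul ..).symm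
      _ ≤ (1 - lam)⁻¹ * (C * M * ‖z‖) := by
          refine mul_le_mul_of_nonneg_right ?_ (by positivity)
          rw [← tsum_geometric_of_lt_one hl0.le hl1]
          exact (summable_geometric_of_lt_one hl0.le hl1).sum_le_tsum _
            fun i _ => pow_nonneg hl0.le i
      _ = ‖z‖ * (C * M / (1 - lam)) := by ring
      _ ≤ (1 - q) / 2 := hzη.le
  have hexp := Real.add_one_le_exp (-∑ i ∈ Finset.range k, Real.log (g (traj f z π i) + 1))
  have hexp1 : Real.exp (-∑ i ∈ Finset.range k, Real.log (g (traj f z π i) + 1)) ≤ 1 :=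
    Real.exp_le_one_iff.mpr (neg_nonpos.mpr (sum_log_nonneg hg0 k z π))
  have hmul := mul_le_of_le_one_left (hh0 j (traj f z π k)) hexp1
  have hhk := (hclose k).2 j
  rw [pathGain, mul_one_sub]
  linarith

/-- A positive lower bound on all path gains forces every trajectory to come close to the origin
within a uniform time. -/
lemma exists_time_norm_traj_lt {X : Set (St n)} (hXdef : X = {x | ∀ j, hX j x < 1})
    (hXbdd : Bornology.IsBounded X) (hh : ∀ j, Continuous (hX j)) (hh0 : ∀ j x, 0 ≤ hX j x)
    (hg : Continuous g) (hg0 : ∀ x, 0 ≤ g x) (hgz : ∀ x, g x = 0 ↔ x = 0) (j₀ : Fin nX)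
    {x : St n} {c : ℝ} (hc : 0 < c)
    (hx : ∀ π, IsPolicy D π → ∀ k j, c ≤ pathGain f hX g k j x π) {ρ : ℝ} (hρ : 0 < ρ) :
    ∃ N : ℕ, ∀ π, IsPolicy D π → ∃ s ≤ N, ‖traj f x π s‖ < ρ := by
  have hK : IsCompact ({z : St n | ∀ j, c ≤ 1 - hX j z} ∩ {z | ρ ≤ ‖z‖}) := by
    refine Metric.isCompact_of_isClosed_isBounded ?_ (hXbdd.subset ?_)
    · refine IsClosed.inter ?_ (isClosed_le continuous_const continuous_norm)
      simp only [ofPred_forall]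
      exact isClosed_iInter fun j => isClosed_le continuous_const (continuous_const.sub (hh j))
    · rw [hXdef]
      exact fun z hz j => by linarith [hz.1 j]
  obtain ⟨ε, hε, hεg⟩ := hK.exists_forall_le' hg.continuousOn (a := 0) fun z hz =>
    (hg0 z).lt_of_ne' fun h0 => by
      have : ρ ≤ ‖z‖ := hz.2
      rw [(hgz z).mp h0, norm_zero] at this
      linarith
  have hL : 0 < Real.log (ε + 1) := Real.log_pos (by linarith)
  obtain ⟨N, hN⟩ := exists_nat_gt (-Real.log c / Real.log (ε + 1))
  rw [div_lt_iff₀ hL] at hN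
  refine ⟨N, fun π hπ => ?_⟩
  by_contra! hfar
  have hsum : N * Real.log (ε + 1) ≤
      ∑ i ∈ Finset.range N, Real.log (g (traj f x π i) + 1) := by
    have := Finset.card_nsmul_le_sum (Finset.range N)
      (fun i => Real.log (g (traj f x π i) + 1)) (Real.log (ε + 1)) fun i hi =>
        Real.log_le_log (by linarith) (by
          linarith [hεg (traj f x π i) ⟨fun j => le_one_sub_of_le_pathGain hg0 hc (hx π hπ i j),
            hfar i (Finset.mem_range.mp hi).le⟩])
    simpa using this
  have hlog := Real.log_le_log hc ((hx π hπ N j₀).trans (pathGain_le_exp hh0 N j₀ x π))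
  rw [Real.log_exp] at hlog
  linarith

/-- Lower bounds on the path gains at a point persist, up to any loss, nearby. -/
lemma eventually_le_pathGain {X : Set (St n)} (hD : IsCompact D)
    (hf : Continuous fun z : St n × St m => f z.1 z.2) (hA : Assumption1 f D X)
    (hXdef : X = {x | ∀ j, hX j x < 1}) (hXbdd : Bornology.IsBounded X)
    (hh : ∀ j, Continuous (hX j)) (hX0 : ∀ j, hX j 0 = 0) (hh0 : ∀ j x, 0 ≤ hX j x)
    (hgd : Differentiable ℝ g) (hg0 : ∀ x, 0 ≤ g x) (hgz : ∀ x, g x = 0 ↔ x = 0) (j₀ : Fin nX)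
    {x : St n} {c c' : ℝ} (hc : 0 < c) (hcc' : c < c')
    (hx : ∀ π, IsPolicy D π → ∀ k j, c' ≤ pathGain f hX g k j x π) :
    ∀ᶠ y in nhds x, ∀ π, IsPolicy D π → ∀ k j, c ≤ pathGain f hX g k j y π := by
  obtain ⟨b, hcb, hbc'⟩ := exists_between hcc'
  have hb : 0 < b := hc.trans hcb
  obtain ⟨ρ, hρ, hnear⟩ := exists_ball_le_pathGain hA hh hX0 hh0 hgd hg0 ((hgz 0).mpr rfl)
    ((div_lt_one hb).mpr hcb)
  obtain ⟨N, hN⟩ := exists_time_norm_traj_lt hXdef hXbdd hh hh0 hgd.continuous hg0 hgz j₀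
    (hb.trans hbc') hx hρ
  have hcpt : IsCompact {π : ℕ → St m | IsPolicy D π} := by
    simpa [IsPolicy, Set.pi] using isCompact_univ_pi fun _ : ℕ => hD
  have hev := hcpt.eventually_forall_of_forall_eventually (x₀ := x)
    (P := fun y π => (∀ s ∈ Finset.range (N + 1), ∀ j, b < pathGain f hX g s j y π) ∧
      ∃ s ≤ N, ‖traj f y π s‖ < ρ) fun π hπ => by
    refine ((Finset.eventually_all _).mpr fun s _ => eventually_all.mpr fun j => ?_).and ?_
    · have hcont := continuous_pathGain hf hh hgd.continuous hg0 s j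
      exact (hcont.tendsto (x, π)).eventually (lt_mem_nhds (hbc'.trans_le (hx π hπ s j)))
    · obtain ⟨s, hs, hlt⟩ := hN π hπ
      have hcont := (continuous_traj hf s).norm
      exact ((hcont.tendsto (x, π)).eventually (gt_mem_nhds hlt)).mono fun _ h => ⟨s, hs, h⟩
  refine hev.mono fun y hy π hπ k j => ?_
  obtain ⟨hfin, s, hs, hlt⟩ := hy π hπ
  rcases le_or_gt k N with hk | hk
  · exact hcb.le.trans (hfin k (by simpa using Nat.lt_succ_of_le hk) j).le
  · obtain ⟨i, rfl⟩ := Nat.exists_eq_add_of_le (hs.trans hk.le)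
    rw [pathGain_add]
    have h1 := (hfin s (by simpa using Nat.lt_succ_of_le hs) j).le.trans
      (pathGain_le_exp hh0 s j y π)
    have h2 := hnear (traj f y π s) hlt (fun i => π (s + i)) (fun i => hπ (s + i)) i j
    calc c = b * (c / b) := by field_simp
      _ ≤ _ := mul_le_mul h1 h2 (div_pos hc hb).le (Real.exp_nonneg _)

lemma continuous_gainInf {X : Set (St n)} (hD : IsCompact D)
    (hf : Continuous fun z : St n × St m => f z.1 z.2) (hA : Assumption1 f D X)
    (hXdef : X = {x | ∀ j, hX j x < 1}) (hXbdd : Bornology.IsBounded X)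
    (hh : ∀ j, Continuous (hX j)) (hX0 : ∀ j, hX j 0 = 0) (hh0 : ∀ j x, 0 ≤ hX j x)
    (hgd : Differentiable ℝ g) (hg0 : ∀ x, 0 ≤ g x) (hgz : ∀ x, g x = 0 ↔ x = 0)
    (j₀ : Fin nX) : Continuous (gainInf f D hX g) := by
  refine continuous_iff_lower_upperSemicontinuous.mpr ⟨fun x a ha => ?_, ?_⟩
  · obtain ⟨c', hc', hc'x⟩ := ENNReal.lt_iff_exists_nnreal_btwn.mp ha
    obtain ⟨c, hac, hcc'⟩ := ENNReal.lt_iff_exists_nnreal_btwn.mp hc'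
    have hc : 0 < c := ENNReal.coe_pos.mp (pos_of_gt hac)
    have hcc : c < c' := ENNReal.coe_lt_coe.mp hcc'
    have key := eventually_le_pathGain hD hf hA hXdef hXbdd hh hX0 hh0 hgd hg0 hgz j₀ (x := x)
      (NNReal.coe_pos.mpr hc) (NNReal.coe_lt_coe.mpr hcc) fun π hπ k j => by
        have h := hc'x.le.trans
          ((iInf₂_le π hπ).trans ((iInf_le _ k).trans (iInf_le _ j)))
        rw [← ENNReal.ofReal_coe_nnreal] at h
        exact (ENNReal.ofReal_le_ofReal_iff' .. |>.mp h).resolve_right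
          (not_le.mpr (NNReal.coe_pos.mpr (hc.trans hcc)))
    refine key.mono fun y hy => hac.trans_le ?_
    refine le_iInf₂ fun π hπ => le_iInf fun k => le_iInf fun j => ?_
    rw [← ENNReal.ofReal_coe_nnreal]
    exact ENNReal.ofReal_le_ofReal (hy π hπ k j)
  · refine upperSemicontinuous_biInf fun π _ => upperSemicontinuous_iInf fun k =>
      upperSemicontinuous_iInf fun j => Continuous.upperSemicontinuous ?_
    exact ENNReal.continuous_ofReal.comp
      ((continuous_pathGain hf hh hgd.continuous hg0 k j).comp (Continuous.prodMk_left π))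

lemma gainInf_ne_top {d : St m} (hd : d ∈ D) (j₀ : Fin nX) (x : St n) :
    gainInf f D hX g x ≠ ∞ := by
  refine ne_top_of_le_ne_top (b := ENNReal.ofReal (pathGain f hX g 0 j₀ x fun _ => d))
    ENNReal.ofReal_ne_top ?_
  exact (iInf₂_le (fun _ => d) fun _ => hd).trans ((iInf_le _ 0).trans (iInf_le _ j₀))

end Gain

theorem stmt12
    {n m nX : ℕ} (hnX : 0 < nX)
    (f : St n → St m → St n) (hfpoly : IsPolyMap2 f)
    (D : Set (St m)) (hD : IsCompact D)
    (hf0 : ∀ d ∈ D, f 0 d = 0)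
    (hX : Fin nX → St n → ℝ) (hXpoly : ∀ j, IsPolyFun (hX j))
    (hX0 : ∀ j, hX j 0 = 0) (hXpos : ∀ j, ∀ x : St n, x ≠ 0 → 0 < hX j x)
    (X : Set (St n)) (hXdef : X = {x | ∀ j, hX j x < 1})
    (hXbdd : Bornology.IsBounded X) (hXopen : IsOpen X)
    (hA1 : Assumption1 f D X)
    (g : St n → ℝ) (hgpoly : IsPolyFun g) (hgnn : ∀ x, 0 ≤ g x)
    (hgzero : ∀ x : St n, g x = 0 ↔ x = 0)
    :
    Continuous (vval f D hX g) := by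
  have hf := hfpoly.continuous
  have hh j := (hXpoly j).differentiable.continuous
  have hh0 (j : Fin nX) (x : St n) : 0 ≤ hX j x := by
    rcases eq_or_ne x 0 with rfl | hx
    · exact (hX0 j).ge
    · exact (hXpos j x hx).le
  have hcont := continuous_gainInf hD hf hA1 hXdef hXbdd hh hX0 hh0 hgpoly.differentiable hgnn
    hgzero ⟨0, hnX⟩
  rcases D.eq_empty_or_nonempty with rfl | ⟨d, hd⟩
  · have hV (x : St n) : Vval f ∅ hX g x = ⊥ := by simp [Vval, IsPolicy]
    have hv : vval f ∅ hX g = fun _ => 0 := by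
      funext x
      simp [vval, hV]
    rw [hv]
    exact continuous_const
  · have hfin := gainInf_ne_top (f := f) (g := g) (hX := hX) hd ⟨0, hnX⟩
    have hv : vval f D hX g = fun x => 1 - (gainInf f D hX g x).toReal := by
      funext x
      refine vval_eq_one_sub fun h => hfin x ?_
      rw [← exp_neg_Vval, h, EReal.neg_bot, EReal.exp_top]
    rw [hv]
    exact continuous_const.sub (ENNReal.continuousOn_toReal.comp_continuous hcont hfin)
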